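/- Let h ∈ (1/2, (√5 − 1)/2) and define w̄(γ) = (1 + γ·(2h−1))/2. Then for every γ ∈ (0,1) one has 1 − w̄(γ) > w̄(γ)², so the high-quality firm's equilibrium profit equals 1 − w̄(γ), and it is strictly decreasing in γ on (0,1). -/

import Mathlib

open Set

noncomputable def wbar (h γ : ℝ) : ℝ := (1 + γ * (2*h - 1))/2

theorem wbar_pos_of_half_lt {h γ : ℝ} (hh : 1/2 < h) (hγ : 0 < γ) : 0 < wbar h γ := by
  have : 0 < γ * (2*h - 1) := mul_pos hγ (by linarith)
  unfold wbar
  linarith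

theorem wbar_lt_of_half_lt {h γ : ℝ} (hh : 1/2 < h) (hγ : γ < 1) : wbar h γ < h := by
  have : 0 < (1 - γ) * (2*h - 1) := mul_pos (by linarith) (by linarith)
  unfold wbar
  linarith

theorem wbar_strictMono {h : ℝ} (hh : 1/2 < h) : StrictMono (wbar h) := by
  intro a b hab
  have : 0 < (b - a) * (2*h - 1) := mul_pos (by linarith) (by linarith)
  unfold wbar
  linarith

theorem sq_lt_one_sub_of_lt_golden {x : ℝ} (hx : 0 < x) (hx' : x < (Real.sqrt 5 - 1)/2) :
    x^2 < 1 - x := by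
  have h5 : (2*x + 1)^2 < 5 := (Real.lt_sqrt (by linarith)).1 (by linarith)
  linarith

/-- For `h ∈ (1/2, (√5−1)/2)`, one has `1 − w̄(γ) > w̄(γ)²` for all `γ ∈ (0,1)`, so the
high-quality firm's equilibrium profit equals `1 − w̄(γ)` and is strictly decreasing
in `γ` on `(0,1)`. -/
theorem stmt16 (h : ℝ) (hh : h ∈ Ioo (1/2:ℝ) ((Real.sqrt 5 - 1)/2)) :
    (∀ γ ∈ Ioo (0:ℝ) 1, (wbar h γ)^2 < 1 - wbar h γ) ∧
    (∀ γ ∈ Ioo (0:ℝ) 1, max (1 - wbar h γ) ((wbar h γ)^2) = 1 - wbar h γ) ∧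
    StrictAntiOn (fun γ => max (1 - wbar h γ) ((wbar h γ)^2)) (Ioo (0:ℝ) 1) := by
  have key : ∀ γ ∈ Ioo (0:ℝ) 1, (wbar h γ)^2 < 1 - wbar h γ := fun γ hγ =>
    sq_lt_one_sub_of_lt_golden (wbar_pos_of_half_lt hh.1 hγ.1)
      ((wbar_lt_of_half_lt hh.1 hγ.2).trans hh.2)
  have profit : ∀ γ ∈ Ioo (0:ℝ) 1, max (1 - wbar h γ) ((wbar h γ)^2) = 1 - wbar h γ :=
    fun γ hγ => max_eq_left (key γ hγ).le
  refine ⟨key, profit, fun a ha b hb hab => ?_⟩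
  simp only [profit a ha, profit b hb]
  exact sub_lt_sub_left (wbar_strictMono hh.1 hab) 1
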